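/- Let n_1, n_2, n_3, n_4 be positive integers and r_1, r_2, r_3, r_4, r_{12}, r_{34} positive integers, and set r = max{r_1,r_2,r_3,r_4,r_{12},r_{34}}. Let S be the set of tensors X ∈ ℝ^{n_1×n_2×n_3×n_4} with ‖X‖_F = 1, rank(X^{{i}}) ≤ r_i for i = 1,2,3,4, rank(X^{{1,2}}) ≤ r_{12}, and rank(X^{{3,4}}) ≤ r_{34}. Then for every ε with 0 < ε ≤ 1 there exists a finite set N of tensors in ℝ^{n_1×n_2×n_3×n_4} with cardinality |N| ≤ (21√r/ε)^{r_{12}·r_{34} + r_{12}·r_1·r_2 + r_{34}·r_3·r_4 + Σ_{i=1}^4 r_i·n_i} such that for every X ∈ S there exists X̄ ∈ N with ‖X − X̄‖_F ≤ ε. -/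

import Mathlib

open scoped BigOperators

noncomputable section

/-- Frobenius norm of a tensor given as a scalar-valued function on a finite index set. -/
def frob {ι : Type*} [Fintype ι] (X : ι → ℝ) : ℝ :=
  Real.sqrt (∑ j, X j ^ 2)

/-- The `S`-matricization of an order-`d` tensor, with rows and columns indexed
(redundantly) by full multi-indices: entry `(a, b)` is `X` evaluated at the multi-index
that agrees with `a` on `S` and with `b` outside `S`.  Its rank coincides with the rank
of the usual `S`-matricization. -/
def matricize {d : ℕ} (n : Fin d → ℕ) (𝕜 : Type*) (S : Finset (Fin d))
    (X : (∀ i, Fin (n i)) → 𝕜) :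
    Matrix (∀ i, Fin (n i)) (∀ i, Fin (n i)) 𝕜 :=
  Matrix.of fun a b => X (fun i => if i ∈ S then a i else b i)

open scoped Matrix Kronecker Matrix.Norms.L2Operator ENNReal
open MeasureTheory Metric

section Nets

variable {E : Type*} [NormedAddCommGroup E] [NormedSpace ℝ E] [FiniteDimensional ℝ E]

/-- Volumetric bound on the cardinality of a separated subset of the unit ball. -/
theorem card_le_of_separated_unitBall {δ : ℝ} (hδ0 : 0 < δ) (hδ1 : δ ≤ 1) (s : Finset E)
    (hs : ∀ c ∈ s, ‖c‖ ≤ 1) (h : ∀ c ∈ s, ∀ d ∈ s, c ≠ d → δ ≤ ‖c - d‖) :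
    (s.card : ℝ) ≤ (3 / δ) ^ Module.finrank ℝ E := by
  borelize E
  let μ : Measure E := Measure.addHaar
  have hδ2 : 0 < δ / 2 := by linarith
  have ρpos : 0 < 3 / 2 := by norm_num
  have D : Set.Pairwise (s : Set E) (Function.onFun Disjoint fun c => ball (c : E) (δ / 2)) := by
    rintro c hc d hd hcd
    apply ball_disjoint_ball
    rw [dist_eq_norm, add_halves]
    exact h c hc d hd hcd
  have A_subset : (⋃ c ∈ s, ball (c : E) (δ / 2)) ⊆ ball (0 : E) (3 / 2) := by
    refine Set.iUnion₂_subset fun x hx => ball_subset_ball' ?_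
    rw [dist_zero_right]
    linarith [hs x hx]
  have I :
    (s.card : ℝ≥0∞) * ENNReal.ofReal ((δ / 2) ^ Module.finrank ℝ E) * μ (ball 0 1) ≤
      ENNReal.ofReal ((3 / 2) ^ Module.finrank ℝ E) * μ (ball 0 1) :=
    calc
      _ = μ (⋃ c ∈ s, ball (c : E) (δ / 2)) := by
        rw [measure_biUnion_finset D fun c _ => measurableSet_ball]
        simp only [μ.addHaar_ball_of_pos _ hδ2]
        simp only [Finset.sum_const, nsmul_eq_mul, mul_assoc]
      _ ≤ μ (ball (0 : E) (3 / 2)) := measure_mono A_subset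
      _ = _ := by simp only [μ.addHaar_ball_of_pos _ (by norm_num : (0 : ℝ) < 3 / 2)]
  have J := (ENNReal.mul_le_mul_iff_left (measure_ball_pos _ _ zero_lt_one).ne'
    measure_ball_lt_top.ne).1 I
  have K := ENNReal.toReal_le_of_le_ofReal (by positivity) J
  rw [ENNReal.toReal_mul, ENNReal.toReal_natCast, ENNReal.toReal_ofReal (by positivity)] at K
  rw [show 3 / δ = (3 / 2) / (δ / 2) by field_simp, div_pow]
  exact (le_div_iff₀ (by positivity)).2 K

/-- The unit ball of a finite-dimensional normed space has a `δ`-net, contained in the ball, of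
cardinality at most `(3 / δ) ^ finrank`. -/
theorem exists_net_unitBall {δ : ℝ} (hδ0 : 0 < δ) (hδ1 : δ ≤ 1) :
    ∃ N : Finset E, (N.card : ℝ) ≤ (3 / δ) ^ Module.finrank ℝ E ∧ (∀ y ∈ N, ‖y‖ ≤ 1) ∧
      ∀ x : E, ‖x‖ ≤ 1 → ∃ y ∈ N, ‖x - y‖ ≤ δ := by
  classical
  let P : Finset E → Prop := fun s =>
    (∀ c ∈ s, ‖c‖ ≤ 1) ∧ ∀ c ∈ s, ∀ d ∈ s, c ≠ d → δ ≤ ‖c - d‖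
  let T : Set ℕ := {k | ∃ s, P s ∧ s.card = k}
  have hne : T.Nonempty := ⟨0, ∅, by simp [P], rfl⟩
  have hbdd : BddAbove T := by
    refine ⟨⌊(3 / δ) ^ Module.finrank ℝ E⌋₊, ?_⟩
    rintro _ ⟨s, hs, rfl⟩
    exact Nat.le_floor (card_le_of_separated_unitBall hδ0 hδ1 s hs.1 hs.2)
  obtain ⟨N, hN, hcard⟩ := Nat.sSup_mem hne hbdd
  refine ⟨N, card_le_of_separated_unitBall hδ0 hδ1 N hN.1 hN.2, hN.1, fun x hx => ?_⟩
  by_contra! hfar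
  have hxN : x ∉ N := fun hxN => by
    have := hfar x hxN
    simp only [sub_self, norm_zero] at this
    linarith
  have hins : P (insert x N) := by
    refine ⟨by simpa using ⟨hx, hN.1⟩, ?_⟩
    intro c hc d hd hcd
    rw [Finset.mem_insert] at hc hd
    rcases hc with rfl | hc <;> rcases hd with rfl | hd
    · exact absurd rfl hcd
    · exact (hfar d hd).le
    · rw [norm_sub_rev]
      exact (hfar c hc).le
    · exact hN.2 c hc d hd hcd
  have := le_csSup hbdd ⟨_, hins, rfl⟩
  rw [Finset.card_insert_of_notMem hxN] at this
  omega

end Nets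

section Frobenius

variable {m n k l : Type*} [Fintype m] [Fintype n] [Fintype k] [Fintype l]

theorem frob_eq_norm {ι : Type*} [Fintype ι] (X : ι → ℝ) : frob X = ‖WithLp.toLp 2 X‖ := by
  simp [frob, EuclideanSpace.norm_eq]

/-- The Frobenius norm of a matrix. -/
def matFrob {m n : Type*} [Fintype m] [Fintype n] (M : Matrix m n ℝ) : ℝ :=
  frob fun p : m × n => M p.1 p.2

theorem matFrob_nonneg (M : Matrix m n ℝ) : 0 ≤ matFrob M := Real.sqrt_nonneg _

theorem matFrob_add_le (M N : Matrix m n ℝ) : matFrob (M + N) ≤ matFrob M + matFrob N := by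
  simp only [matFrob, frob_eq_norm]
  exact norm_add_le (WithLp.toLp 2 fun p : m × n => M p.1 p.2)
    (WithLp.toLp 2 fun p : m × n => N p.1 p.2)

theorem matFrob_conjTranspose (M : Matrix m n ℝ) : matFrob Mᴴ = matFrob M := by
  unfold matFrob frob
  congr 1
  exact Fintype.sum_equiv (Equiv.prodComm n m) _ _ fun p => by simp

theorem matFrob_sq (M : Matrix m n ℝ) :
    matFrob M ^ 2 = ∑ j, ‖WithLp.toLp 2 (M.col j)‖ ^ 2 := by
  rw [matFrob, frob, Real.sq_sqrt (by positivity), Fintype.sum_prod_type_right]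
  simp [EuclideanSpace.norm_sq_eq]

theorem matFrob_mul_le [DecidableEq n] (A : Matrix m n ℝ) (M : Matrix n k ℝ) :
    matFrob (A * M) ≤ ‖A‖ * matFrob M := by
  refine le_of_sq_le_sq ?_ (mul_nonneg (norm_nonneg _) (matFrob_nonneg _))
  rw [mul_pow, matFrob_sq, matFrob_sq, Finset.mul_sum]
  refine Finset.sum_le_sum fun j _ => ?_
  rw [← mul_pow]
  refine pow_le_pow_left₀ (norm_nonneg _) ?_ 2
  exact Matrix.l2_opNorm_mulVec A (WithLp.toLp 2 (M.col j))

theorem matFrob_mul_mul_conjTranspose_le [DecidableEq n] [DecidableEq k] (A : Matrix m n ℝ) (M : Matrix n k ℝ)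
    (B : Matrix l k ℝ) : matFrob (A * M * Bᴴ) ≤ ‖A‖ * matFrob M * ‖B‖ := by
  rw [← matFrob_conjTranspose, Matrix.conjTranspose_mul, Matrix.conjTranspose_conjTranspose]
  refine (matFrob_mul_le _ _).trans ?_
  rw [matFrob_conjTranspose, mul_comm]
  exact mul_le_mul_of_nonneg_right (matFrob_mul_le _ _) (norm_nonneg _)

theorem l2_opNorm_kronecker_le [DecidableEq n] [DecidableEq l] (A : Matrix m n ℝ) (B : Matrix k l ℝ) :
    ‖A ⊗ₖ B‖ ≤ ‖A‖ * ‖B‖ := by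
  rw [Matrix.l2_opNorm_def (A ⊗ₖ B)]
  refine ContinuousLinearMap.opNorm_le_bound _ (by positivity) fun x => ?_
  have h := matFrob_mul_mul_conjTranspose_le B
    (Matrix.of fun (i : l) (j : n) => x (j, i)) A
  have h1 : matFrob (Matrix.of fun (i : l) (j : n) => x (j, i)) = ‖x‖ := by
    rw [matFrob, frob, EuclideanSpace.norm_eq]
    congr 1
    exact Fintype.sum_equiv (Equiv.prodComm l n) _ _ fun p => by simp [Prod.swap]
  have h2 : matFrob (B * (Matrix.of fun (i : l) (j : n) => x (j, i)) * Aᴴ) =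
      ‖WithLp.toLp 2 ((A ⊗ₖ B) *ᵥ x.ofLp)‖ := by
    have := Matrix.kronecker_mulVec_vec B (Matrix.of fun (i : l) (j : n) => x (j, i)) A
    rw [Matrix.conjTranspose_eq_transpose_of_trivial, EuclideanSpace.norm_eq, matFrob, frob]
    congr 1
    refine Fintype.sum_equiv (Equiv.prodComm k m) _ _ fun p => ?_
    have h3 := congrFun this (p.2, p.1)
    rw [Real.norm_eq_abs, sq_abs]
    congr 1
    exact h3.symm
  rw [h1, h2] at h
  calc _ ≤ ‖B‖ * ‖x‖ * ‖A‖ := h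
    _ = _ := by ring

theorem norm_mul_sub_mul_le [DecidableEq n] [DecidableEq k] {A A' : Matrix m n ℝ} {B B' : Matrix n k ℝ} {a b : ℝ}
    (hA : ‖A‖ ≤ 1) (hB' : ‖B'‖ ≤ 1) (ha : ‖A - A'‖ ≤ a) (hb : ‖B - B'‖ ≤ b) :
    ‖A * B - A' * B'‖ ≤ a + b := by
  have h : A * B - A' * B' = A * (B - B') + (A - A') * B' := by
    rw [Matrix.mul_sub, Matrix.sub_mul]; abel
  rw [h]
  have h1 := (Matrix.l2_opNorm_mul A (B - B')).trans
    (mul_le_of_le_one_left (norm_nonneg _) hA)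
  have h2 := (Matrix.l2_opNorm_mul (A - A') B').trans
    (mul_le_of_le_one_right (norm_nonneg _) hB')
  linarith [norm_add_le (A * (B - B')) ((A - A') * B')]

theorem norm_kronecker_sub_kronecker_le [DecidableEq n] [DecidableEq l] {A A' : Matrix m n ℝ} {B B' : Matrix k l ℝ} {a b : ℝ}
    (hA : ‖A‖ ≤ 1) (hB' : ‖B'‖ ≤ 1) (ha : ‖A - A'‖ ≤ a) (hb : ‖B - B'‖ ≤ b) :
    ‖A ⊗ₖ B - A' ⊗ₖ B'‖ ≤ a + b := by
  have h : A ⊗ₖ B - A' ⊗ₖ B' = A ⊗ₖ (B - B') + (A - A') ⊗ₖ B' := by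
    ext i j
    simp [Matrix.kroneckerMap_apply]
    ring
  rw [h]
  have h1 := (l2_opNorm_kronecker_le A (B - B')).trans
    (mul_le_of_le_one_left (norm_nonneg _) hA)
  have h2 := (l2_opNorm_kronecker_le (A - A') B').trans
    (mul_le_of_le_one_right (norm_nonneg _) hB')
  linarith [norm_add_le (A ⊗ₖ (B - B')) ((A - A') ⊗ₖ B')]

theorem exists_net_opNorm (m n : Type*) [Fintype m] [Fintype n] [DecidableEq n]
    {δ : ℝ} (hδ0 : 0 < δ) (hδ1 : δ ≤ 1) :
    ∃ N : Finset (Matrix m n ℝ), (N.card : ℝ) ≤ (3 / δ) ^ (Fintype.card m * Fintype.card n) ∧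
      (∀ y ∈ N, ‖y‖ ≤ 1) ∧ ∀ x : Matrix m n ℝ, ‖x‖ ≤ 1 → ∃ y ∈ N, ‖x - y‖ ≤ δ := by
  simpa [Module.finrank_matrix] using exists_net_unitBall (E := Matrix m n ℝ) hδ0 hδ1

theorem exists_net_matFrob (m n : Type*) [Fintype m] [Fintype n]
    {δ : ℝ} (hδ0 : 0 < δ) (hδ1 : δ ≤ 1) :
    ∃ N : Finset (Matrix m n ℝ), (N.card : ℝ) ≤ (3 / δ) ^ (Fintype.card m * Fintype.card n) ∧
      (∀ y ∈ N, matFrob y ≤ 1) ∧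
      ∀ x : Matrix m n ℝ, matFrob x ≤ 1 → ∃ y ∈ N, matFrob (x - y) ≤ δ := by
  classical
  obtain ⟨N, h1, h2, h3⟩ := exists_net_unitBall (E := EuclideanSpace ℝ (m × n)) hδ0 hδ1
  refine ⟨N.image fun y => Matrix.of fun i j => y (i, j), ?_, ?_, ?_⟩
  · rw [finrank_euclideanSpace, Fintype.card_prod] at h1
    exact le_trans (by exact_mod_cast Finset.card_image_le) h1
  · intro y hy
    obtain ⟨z, hz, rfl⟩ := Finset.mem_image.1 hy
    rw [matFrob, frob_eq_norm]
    exact h2 z hz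
  · intro x hx
    rw [matFrob, frob_eq_norm] at hx
    obtain ⟨y, hy, hxy⟩ := h3 _ hx
    refine ⟨_, Finset.mem_image_of_mem _ hy, ?_⟩
    rw [matFrob, frob_eq_norm]
    exact hxy

end Frobenius

section Factorization

theorem l2_opNorm_le_one_of_conjTranspose_mul_self {m n : Type*} [Fintype m] [Fintype n]
    [DecidableEq n] {U : Matrix m n ℝ} (h : Uᴴ * U = 1) : ‖U‖ ≤ 1 := by
  have h1 := Matrix.l2_opNorm_conjTranspose_mul_self U
  have h2 := Matrix.l2_opNorm_conjTranspose_mul_self (1 : Matrix n n ℝ)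
  rw [h] at h1
  rw [Matrix.conjTranspose_one, Matrix.one_mul] at h2
  have h3 : ‖(1 : Matrix n n ℝ)‖ ≤ 1 := by
    by_contra! hlt
    nlinarith
  nlinarith [norm_nonneg U]

/-- Orthonormal coordinates on the column space of a matrix, padded with zero columns. -/
theorem exists_contraction_of_rank_le {m n : Type*} [Fintype m] [Fintype n]
    (A : Matrix m n ℝ) {r : ℕ} (h : A.rank ≤ r) :
    ∃ (W : Matrix m (Fin r) ℝ) (Z : Matrix n (Fin r) ℝ),
      W = A * Z ∧ W * Wᴴ * A = A ∧ ‖W‖ ≤ 1 := by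
  classical
  let V : Submodule ℝ (EuclideanSpace ℝ m) := LinearMap.range (Matrix.toEuclideanLin A)
  have hV : Module.finrank ℝ V = A.rank := by
    rw [A.rank_eq_finrank_range_toLin (PiLp.basisFun 2 ℝ m) (PiLp.basisFun 2 ℝ n),
      ← Matrix.toLpLin_eq_toLin]
  let b := stdOrthonormalBasis ℝ V
  have hbmem : ∀ i, ∃ z : EuclideanSpace ℝ n, Matrix.toEuclideanLin A z = b i := fun i => (b i).2
  choose z hz using hbmem
  have hle : Module.finrank ℝ V ≤ r := hV ▸ h
  let U : Matrix m (Fin (Module.finrank ℝ V)) ℝ := Matrix.of fun i j => (b j : EuclideanSpace ℝ m) i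
  let Z : Matrix n (Fin (Module.finrank ℝ V)) ℝ := Matrix.of fun i j => z j i
  let E : Matrix (Fin (Module.finrank ℝ V)) (Fin r) ℝ :=
    (1 : Matrix (Fin r) (Fin r) ℝ).submatrix (Fin.castLE hle) id
  have hE : E * Eᴴ = 1 := by
    ext i j
    simp [E, Matrix.mul_apply, Matrix.one_apply]
  have hUZ : U = A * Z := by
    ext i j
    have := congrArg (fun v : EuclideanSpace ℝ m => v i) (hz j)
    exact this.symm
  have hUU : Uᴴ * U = 1 := by
    ext i j
    have := b.inner_eq_ite j i
    rw [Submodule.coe_inner, PiLp.inner_apply] at this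
    rw [Matrix.one_apply, if_congr eq_comm rfl rfl, ← this]
    simp [Matrix.mul_apply, U]
  have hmem : ∀ j, WithLp.toLp 2 (A.col j) ∈ V := fun j => by
    refine ⟨WithLp.toLp 2 (Pi.single j 1), ?_⟩
    ext i
    simp [Matrix.toLpLin_apply]
  have hUY : A = U * Matrix.of fun i j => b.repr ⟨_, hmem j⟩ i := by
    ext i j
    have h1 := congrArg (fun v : V => (v : EuclideanSpace ℝ m) i) (b.sum_repr ⟨_, hmem j⟩)
    simp only [Submodule.coe_sum, Submodule.coe_smul, WithLp.ofLp_sum, Finset.sum_apply] at h1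
    rw [Matrix.mul_apply]
    refine h1.symm.trans (Finset.sum_congr rfl fun k _ => ?_)
    exact mul_comm _ _
  have hUA : U * Uᴴ * A = A := by
    conv_lhs => rw [hUY, ← Matrix.mul_assoc, Matrix.mul_assoc U, hUU, Matrix.mul_one, ← hUY]
  have hWW : U * E * (U * E)ᴴ = U * Uᴴ := by
    rw [Matrix.conjTranspose_mul, Matrix.mul_assoc, ← Matrix.mul_assoc E, hE, Matrix.one_mul]
  refine ⟨U * E, Z * E, ?_, ?_, ?_⟩
  · rw [hUZ, Matrix.mul_assoc]
  · rw [hWW, hUA]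
  · have hEn : ‖E‖ ≤ 1 := by
      rw [← Matrix.l2_opNorm_conjTranspose]
      exact l2_opNorm_le_one_of_conjTranspose_mul_self (by rwa [Matrix.conjTranspose_conjTranspose])
    have hUn : ‖U‖ ≤ 1 := l2_opNorm_le_one_of_conjTranspose_mul_self hUU
    exact (Matrix.l2_opNorm_mul _ _).trans (mul_le_one₀ hUn (norm_nonneg _) hEn)

/-- Net for the frames of one side of the tree: a Kronecker product of leaf frames times a
transfer matrix. -/
theorem exists_net_frames (a b p q s : ℕ) {δ : ℝ} (hδ0 : 0 < δ) (hδ1 : δ ≤ 1) :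
    ∃ N : Finset (Matrix (Fin a × Fin b) (Fin s) ℝ),
      (N.card : ℝ) ≤ (3 / δ) ^ (s * p * q + (p * a + q * b)) ∧
      (∀ L ∈ N, ‖L‖ ≤ 1) ∧
      ∀ {n : Type} [Fintype n] (A : Matrix (Fin a × Fin b) n ℝ),
        (Matrix.of fun i (j : Fin b × n) => A (i, j.1) j.2).rank ≤ p →
        (Matrix.of fun i (j : Fin a × n) => A (j.1, i) j.2).rank ≤ q →
        A.rank ≤ s →
        ∃ W : Matrix (Fin a × Fin b) (Fin s) ℝ, W * Wᴴ * A = A ∧ ‖W‖ ≤ 1 ∧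
          ∃ L ∈ N, ‖W - L‖ ≤ 3 * δ := by
  classical
  obtain ⟨N1, hc1, hn1, h1⟩ := exists_net_opNorm (Fin a) (Fin p) hδ0 hδ1
  obtain ⟨N2, hc2, hn2, h2⟩ := exists_net_opNorm (Fin b) (Fin q) hδ0 hδ1
  obtain ⟨N3, hc3, hn3, h3⟩ := exists_net_opNorm (Fin p × Fin q) (Fin s) hδ0 hδ1
  refine ⟨(N1 ×ˢ N2 ×ˢ N3).image fun t => (t.1 ⊗ₖ t.2.1) * t.2.2, ?_, ?_, ?_⟩
  · refine (Nat.cast_le.2 Finset.card_image_le).trans ?_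
    rw [Finset.card_product, Finset.card_product]
    push_cast
    simp only [Fintype.card_prod, Fintype.card_fin] at hc1 hc2 hc3
    calc _ ≤ (3 / δ) ^ (a * p) * ((3 / δ) ^ (b * q) * (3 / δ) ^ (p * q * s)) := by gcongr
      _ = _ := by rw [← pow_add, ← pow_add]; congr 1; ring
  · intro L hL
    obtain ⟨⟨x, y, z⟩, ht, rfl⟩ := Finset.mem_image.1 hL
    simp only [Finset.mem_product] at ht
    refine (Matrix.l2_opNorm_mul _ _).trans (mul_le_one₀ ?_ (norm_nonneg _) (hn3 _ ht.2.2))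
    exact (l2_opNorm_kronecker_le _ _).trans
      (mul_le_one₀ (hn1 _ ht.1) (norm_nonneg _) (hn2 _ ht.2.1))
  · intro n _ A hA1 hA2 hA
    obtain ⟨U, -, -, hU, hUn⟩ := exists_contraction_of_rank_le _ hA1
    obtain ⟨V, -, -, hV, hVn⟩ := exists_contraction_of_rank_le _ hA2
    obtain ⟨W, Z, hWZ, hW, hWn⟩ := exists_contraction_of_rank_le _ hA
    have hK : ‖U ⊗ₖ V‖ ≤ 1 := (l2_opNorm_kronecker_le _ _).trans
      (mul_le_one₀ hUn (norm_nonneg _) hVn)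
    have hUA : ((U * Uᴴ) ⊗ₖ (1 : Matrix (Fin b) (Fin b) ℝ)) * A = A := by
      ext ⟨i, j⟩ k
      have := congrFun (congrFun hU i) (j, k)
      rw [Matrix.mul_apply] at this
      simpa [Matrix.mul_apply (N := A),
        Fintype.sum_prod_type, Matrix.one_apply] using this
    have hVA : ((1 : Matrix (Fin a) (Fin a) ℝ) ⊗ₖ (V * Vᴴ)) * A = A := by
      ext ⟨i, j⟩ k
      have := congrFun (congrFun hV j) (i, k)
      rw [Matrix.mul_apply] at this
      simpa [Matrix.mul_apply (N := A),
        Fintype.sum_prod_type, Matrix.one_apply] using this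
    have hKA : (U ⊗ₖ V) * (U ⊗ₖ V)ᴴ * A = A := by
      rw [Matrix.conjTranspose_kronecker, ← Matrix.mul_kronecker_mul]
      conv_rhs => rw [← hUA, ← hVA]
      rw [← Matrix.mul_assoc, ← Matrix.mul_kronecker_mul, Matrix.mul_one, Matrix.one_mul]
    have hKW : (U ⊗ₖ V) * ((U ⊗ₖ V)ᴴ * W) = W := by
      rw [hWZ, ← Matrix.mul_assoc, ← Matrix.mul_assoc, hKA]
    have hBn : ‖(U ⊗ₖ V)ᴴ * W‖ ≤ 1 := (Matrix.l2_opNorm_mul _ _).trans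
      (mul_le_one₀ (by rwa [Matrix.l2_opNorm_conjTranspose]) (norm_nonneg _) hWn)
    obtain ⟨U', hU', hUd⟩ := h1 U hUn
    obtain ⟨V', hV', hVd⟩ := h2 V hVn
    obtain ⟨B', hB', hBd⟩ := h3 _ hBn
    refine ⟨W, hW, hWn, _, Finset.mem_image_of_mem _
      (Finset.mk_mem_product hU' (Finset.mk_mem_product hV' hB')), ?_⟩
    have := norm_mul_sub_mul_le hK (hn3 _ hB')
      (norm_kronecker_sub_kronecker_le hUn (hn2 _ hV') hUd hVd) hBd
    rw [hKW] at this
    linarith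

end Factorization

section MultiIndex

variable {n₁ n₂ n₃ n₄ : ℕ}

/-- The multi-index with the given four coordinates. -/
def tuple₄ (a : Fin n₁) (b : Fin n₂) (c : Fin n₃) (d : Fin n₄) :
    ∀ i : Fin 4, Fin (![n₁, n₂, n₃, n₄] i)
  | 0 => a
  | 1 => b
  | 2 => c
  | 3 => d

/-- Splitting a multi-index into its first two and its last two coordinates. -/
def tuple₄Equiv (n₁ n₂ n₃ n₄ : ℕ) :
    (Fin n₁ × Fin n₂) × (Fin n₃ × Fin n₄) ≃ (∀ i : Fin 4, Fin (![n₁, n₂, n₃, n₄] i)) where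
  toFun p := tuple₄ p.1.1 p.1.2 p.2.1 p.2.2
  invFun f := ((f 0, f 1), (f 2, f 3))
  left_inv _ := rfl
  right_inv f := by
    funext i
    fin_cases i <;> rfl

end MultiIndex

theorem covering_number_HT_order4
    (n₁ n₂ n₃ n₄ : ℕ) (hn₁ : 0 < n₁) (hn₂ : 0 < n₂) (hn₃ : 0 < n₃) (hn₄ : 0 < n₄)
    (r₁ r₂ r₃ r₄ r₁₂ r₃₄ : ℕ)
    (hr₁ : 0 < r₁) (hr₂ : 0 < r₂) (hr₃ : 0 < r₃) (hr₄ : 0 < r₄)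
    (hr₁₂ : 0 < r₁₂) (hr₃₄ : 0 < r₃₄)
    (rmax : ℕ) (hrmax : rmax = max (max (max r₁ r₂) (max r₃ r₄)) (max r₁₂ r₃₄))
    (ε : ℝ) (hε0 : 0 < ε) (hε1 : ε ≤ 1) :
    ∃ N : Finset ((∀ i : Fin 4, Fin (![n₁, n₂, n₃, n₄] i)) → ℝ),
      (N.card : ℝ) ≤ (21 * Real.sqrt rmax / ε)
          ^ (r₁₂ * r₃₄ + r₁₂ * r₁ * r₂ + r₃₄ * r₃ * r₄
              + (r₁ * n₁ + r₂ * n₂ + r₃ * n₃ + r₄ * n₄)) ∧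
      ∀ X : (∀ i : Fin 4, Fin (![n₁, n₂, n₃, n₄] i)) → ℝ,
        (matricize ![n₁, n₂, n₃, n₄] ℝ {0} X).rank ≤ r₁ →
        (matricize ![n₁, n₂, n₃, n₄] ℝ {1} X).rank ≤ r₂ →
        (matricize ![n₁, n₂, n₃, n₄] ℝ {2} X).rank ≤ r₃ →
        (matricize ![n₁, n₂, n₃, n₄] ℝ {3} X).rank ≤ r₄ →
        (matricize ![n₁, n₂, n₃, n₄] ℝ {0, 1} X).rank ≤ r₁₂ →
        (matricize ![n₁, n₂, n₃, n₄] ℝ {2, 3} X).rank ≤ r₃₄ →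
        frob X = 1 →
        ∃ Y ∈ N, frob (X - Y) ≤ ε := by
  classical
  have hδ0 : 0 < ε / 7 := by positivity
  have hδ1 : ε / 7 ≤ 1 := by linarith
  obtain ⟨N1, hc1, hn1, h1⟩ := exists_net_frames n₁ n₂ r₁ r₂ r₁₂ hδ0 hδ1
  obtain ⟨N2, hc2, hn2, h2⟩ := exists_net_frames n₃ n₄ r₃ r₄ r₃₄ hδ0 hδ1
  obtain ⟨N3, hc3, hn3, h3⟩ := exists_net_matFrob (Fin r₁₂) (Fin r₃₄) hδ0 hδ1
  have hrmax1 : 1 ≤ rmax := by omega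
  have h3δ : 3 / (ε / 7) ≤ 21 * Real.sqrt rmax / ε := by
    have : 1 ≤ Real.sqrt rmax := Real.one_le_sqrt.2 (by exact_mod_cast hrmax1)
    rw [div_div_eq_mul_div]
    refine div_le_div_of_nonneg_right ?_ hε0.le
    linarith
  refine ⟨(N1 ×ˢ N2 ×ˢ N3).image fun t i => (t.1 * t.2.2 * t.2.1ᴴ) (i 0, i 1) (i 2, i 3), ?_, ?_⟩
  · refine (Nat.cast_le.2 Finset.card_image_le).trans ?_
    rw [Finset.card_product, Finset.card_product]
    push_cast
    simp only [Fintype.card_fin] at hc3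
    refine le_trans ?_ (pow_le_pow_left₀ (by positivity) h3δ _)
    calc _ ≤ (3 / (ε / 7)) ^ (r₁₂ * r₁ * r₂ + (r₁ * n₁ + r₂ * n₂)) *
          ((3 / (ε / 7)) ^ (r₃₄ * r₃ * r₄ + (r₃ * n₃ + r₄ * n₄)) *
            (3 / (ε / 7)) ^ (r₁₂ * r₃₄)) := by gcongr
      _ = _ := by rw [← pow_add, ← pow_add]; congr 1; ring
  · intro X hX1 hX2 hX3 hX4 hX12 hX34 hX
    let A : Matrix (Fin n₁ × Fin n₂) (Fin n₃ × Fin n₄) ℝ :=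
      Matrix.of fun p q => X (tuple₄ p.1 p.2 q.1 q.2)
    let d₁ : Fin n₁ := ⟨0, hn₁⟩
    let d₂ : Fin n₂ := ⟨0, hn₂⟩
    let d₃ : Fin n₃ := ⟨0, hn₃⟩
    let d₄ : Fin n₄ := ⟨0, hn₄⟩
    have hA : A.rank ≤ r₁₂ := by
      refine le_trans (le_of_eq_of_le (congrArg Matrix.rank ?_) (Matrix.rank_submatrix_le _
        (fun p : Fin n₁ × Fin n₂ => tuple₄ p.1 p.2 d₃ d₄)
        (fun q : Fin n₃ × Fin n₄ => tuple₄ d₁ d₂ q.1 q.2))) hX12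
      ext p q
      refine congrArg X (funext fun i => ?_)
      fin_cases i <;> rfl
    have hA' : Aᴴ.rank ≤ r₃₄ := by
      refine le_trans (le_of_eq_of_le (congrArg Matrix.rank ?_) (Matrix.rank_submatrix_le _
        (fun q : Fin n₃ × Fin n₄ => tuple₄ d₁ d₂ q.1 q.2)
        (fun p : Fin n₁ × Fin n₂ => tuple₄ p.1 p.2 d₃ d₄))) hX34
      ext p q
      refine congrArg X (funext fun i => ?_)
      fin_cases i <;> rfl
    obtain ⟨W, hW, hWn, L, hL, hWL⟩ := h1 A
      (by
        refine le_trans (le_of_eq_of_le (congrArg Matrix.rank ?_) (Matrix.rank_submatrix_le _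
          (fun i => tuple₄ i d₂ d₃ d₄) (fun j => tuple₄ d₁ j.1 j.2.1 j.2.2))) hX1
        ext p q
        refine congrArg X (funext fun i => ?_)
        fin_cases i <;> rfl)
      (by
        refine le_trans (le_of_eq_of_le (congrArg Matrix.rank ?_) (Matrix.rank_submatrix_le _
          (fun i => tuple₄ d₁ i d₃ d₄) (fun j => tuple₄ j.1 d₂ j.2.1 j.2.2))) hX2
        ext p q
        refine congrArg X (funext fun i => ?_)
        fin_cases i <;> rfl) hA
    obtain ⟨V, hV, hVn, R, hR, hVR⟩ := h2 Aᴴ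
      (by
        refine le_trans (le_of_eq_of_le (congrArg Matrix.rank ?_) (Matrix.rank_submatrix_le _
          (fun i => tuple₄ d₁ d₂ i d₄) (fun j => tuple₄ j.2.1 j.2.2 d₃ j.1))) hX3
        ext p q
        refine congrArg X (funext fun i => ?_)
        fin_cases i <;> rfl)
      (by
        refine le_trans (le_of_eq_of_le (congrArg Matrix.rank ?_) (Matrix.rank_submatrix_le _
          (fun i => tuple₄ d₁ d₂ d₃ i) (fun j => tuple₄ j.2.1 j.2.2 j.1 d₄))) hX4
        ext p q
        refine congrArg X (funext fun i => ?_)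
        fin_cases i <;> rfl) hA'
    have hfrob : ∀ Y : (∀ i : Fin 4, Fin (![n₁, n₂, n₃, n₄] i)) → ℝ,
        frob Y = matFrob (Matrix.of fun (p : Fin n₁ × Fin n₂) (q : Fin n₃ × Fin n₄) =>
          Y (tuple₄ p.1 p.2 q.1 q.2)) := fun Y => by
      unfold matFrob frob
      congr 1
      exact (Fintype.sum_equiv (tuple₄Equiv n₁ n₂ n₃ n₄) _ _ fun p => rfl).symm
    have hAn : matFrob A ≤ 1 := (hfrob X).symm.trans hX |>.le
    have hCn : matFrob (Wᴴ * A * V) ≤ 1 := by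
      have h := matFrob_mul_mul_conjTranspose_le Wᴴ A Vᴴ
      rw [Matrix.conjTranspose_conjTranspose, Matrix.l2_opNorm_conjTranspose,
        Matrix.l2_opNorm_conjTranspose] at h
      exact h.trans (mul_le_one₀ (mul_le_one₀ hWn (matFrob_nonneg _) hAn) (norm_nonneg _) hVn)
    obtain ⟨C, hC, hCd⟩ := h3 _ hCn
    refine ⟨_, Finset.mem_image_of_mem _
      (Finset.mk_mem_product hL (Finset.mk_mem_product hR hC)), ?_⟩
    have hAV : A * V * Vᴴ = A := by
      have := congrArg Matrix.conjTranspose hV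
      simpa [Matrix.conjTranspose_mul, Matrix.mul_assoc] using this
    have hdec : A - L * C * Rᴴ = (W - L) * (Wᴴ * A * V) * Vᴴ
        + (L * (Wᴴ * A * V - C) * Vᴴ + L * C * (V - R)ᴴ) := by
      have hA2 : W * (Wᴴ * A * V) * Vᴴ = A := by
        rw [← Matrix.mul_assoc, ← Matrix.mul_assoc, hW, hAV]
      rw [Matrix.conjTranspose_sub, Matrix.sub_mul, Matrix.sub_mul, hA2, Matrix.mul_sub,
        Matrix.sub_mul, Matrix.mul_sub]
      abel
    have e1 : matFrob ((W - L) * (Wᴴ * A * V) * Vᴴ) ≤ 3 * (ε / 7) * 1 * 1 :=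
      (matFrob_mul_mul_conjTranspose_le _ _ _).trans <| by
        have := matFrob_nonneg (Wᴴ * A * V)
        gcongr
    have e2 : matFrob (L * (Wᴴ * A * V - C) * Vᴴ) ≤ 1 * (ε / 7) * 1 :=
      (matFrob_mul_mul_conjTranspose_le _ _ _).trans <| by
        have := matFrob_nonneg (Wᴴ * A * V - C)
        have := hn1 L hL
        gcongr
    have e3 : matFrob (L * C * (V - R)ᴴ) ≤ 1 * 1 * (3 * (ε / 7)) :=
      (matFrob_mul_mul_conjTranspose_le _ _ _).trans <| by
        have := matFrob_nonneg C
        have := hn1 L hL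
        have := hn3 C hC
        gcongr
    have hfin : matFrob (A - L * C * Rᴴ) ≤ ε := by
      rw [hdec]
      refine (matFrob_add_le _ _).trans ?_
      linarith [matFrob_add_le (L * (Wᴴ * A * V - C) * Vᴴ) (L * C * (V - R)ᴴ)]
    rw [hfrob]
    exact hfin
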